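/- Let N ∈ ℕ*, σ > 0, and W be an N×N random matrix with i.i.d. entries distributed as N(0, σ²). Let B_{T,N} be its generalised matrix of moments (with u = (1,...,1)^T). Then for all l₁, l₂ ∈ {0,...,T-1}: B_{T,N}(l₁,l₂) ≤ (1/(σ²N)) B_{T,N}(l₁+1, l₂+1). -/

import Mathlib

open MeasureTheory ProbabilityTheory Matrix

lemma g_int (v : NNReal) (n : ℕ) : Integrable (fun x : ℝ => x ^ n) (gaussianReal 0 v) := by
  have h := (memLp_id_gaussianReal (μ := 0) (v := v) (n : NNReal))
  have h2 := h.integrable_norm_pow' 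
  refine (integrable_norm_iff (by fun_prop)).1 ?_
  simpa [norm_pow] using h2

lemma g_odd (v : NNReal) (n : ℕ) (hn : Odd n) : ∫ x : ℝ, x ^ n ∂(gaussianReal 0 v) = 0 := by
  have h : Measure.map (fun x : ℝ => -x) (gaussianReal 0 v) = gaussianReal 0 v := by
    simpa using gaussianReal_map_neg (μ := 0) (v := v)
  have h1 : ∫ x : ℝ, x ^ n ∂(gaussianReal 0 v) = ∫ x : ℝ, (-x) ^ n ∂(gaussianReal 0 v) := by
    conv_lhs => rw [← h]
    rw [integral_map (by fun_prop) (by fun_prop)]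
  simp only [hn.neg_pow, integral_neg] at h1
  linarith

lemma g_nonneg (v : NNReal) (n : ℕ) : 0 ≤ ∫ x : ℝ, x ^ n ∂(gaussianReal 0 v) := by
  rcases Nat.even_or_odd n with h | h
  · exact integral_nonneg fun x => h.pow_nonneg x
  · rw [g_odd v n h]

lemma g_two (v : NNReal) : ∫ x : ℝ, x ^ 2 ∂(gaussianReal 0 v) = v := by
  have h := variance_id_gaussianReal (μ := 0) (v := v)
  rw [variance_eq_integral (by fun_prop)] at h
  simpa using h

lemma g_step (v : NNReal) (n : ℕ) :
    (v : ℝ) * ∫ x : ℝ, x ^ n ∂(gaussianReal 0 v) ≤ ∫ x : ℝ, x ^ (n + 2) ∂(gaussianReal 0 v) := by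
  rcases Nat.even_or_odd n with h | h
  · obtain ⟨k, rfl⟩ := h
    have h0 : 0 ≤ ∫ x : ℝ, (x ^ (k + k + 2) - (v:ℝ) * x ^ (k+k)) - ((v:ℝ) ^ k * x ^ 2 - (v:ℝ) ^ k * v)
        ∂(gaussianReal 0 v) := by
      refine integral_nonneg fun x => ?_
      have e : (x ^ (k + k + 2) - (v:ℝ) * x ^ (k+k)) - ((v:ℝ) ^ k * x ^ 2 - (v:ℝ) ^ k * v)
        = (x ^ 2 - v) * ((x ^ 2) ^ k - (v:ℝ) ^ k) := by ring
      simp only [e, Pi.zero_apply]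
      rcases le_total (x ^ 2) (v : ℝ) with h | h
      · exact mul_nonneg_of_nonpos_of_nonpos (by linarith)
          (sub_nonpos.2 (pow_le_pow_left₀ (sq_nonneg x) h k))
      · exact mul_nonneg (by linarith) (sub_nonneg.2 (pow_le_pow_left₀ v.2 h k))
    have i1 := g_int v (k + k + 2)
    have i2 := (g_int v (k + k)).const_mul (v : ℝ)
    have i3 := (g_int v 2).const_mul ((v : ℝ) ^ k)
    have i4 : Integrable (fun _ : ℝ => (v:ℝ) ^ k * v) (gaussianReal 0 v) := integrable_const _
    rw [integral_sub (by exact i1.sub i2) (by exact i3.sub i4), integral_sub i1 i2, integral_sub i3 i4,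
      integral_const_mul, integral_const_mul, g_two] at h0
    simp at h0
    linarith
  · rw [g_odd v n h, g_odd v (n + 2) (by simpa [Nat.odd_add] using h)]; simp

section
variable {ι : Type*} [Fintype ι] 

lemma ae_mon (s : ι →₀ ℕ) (c : ℕ) (x : ι → ℝ) :
    MvPolynomial.aeval x (MvPolynomial.monomial s c) = (c : ℝ) * ∏ i, x i ^ s i := by
  rw [MvPolynomial.aeval_monomial, Finsupp.prod_fintype _ _ (by simp)]; simp

lemma p_int (v : NNReal) (P : MvPolynomial ι ℕ) :
    Integrable (fun x : ι → ℝ => MvPolynomial.aeval x P)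
      (Measure.pi fun _ => gaussianReal 0 v) := by
  induction P using MvPolynomial.induction_on' with
  | monomial s c =>
    simp only [ae_mon]
    exact (Integrable.fintype_prod (f := fun i (y : ℝ) => y ^ s i) fun i => g_int v (s i)).const_mul _
  | add p q hp hq => simp only [map_add]; exact hp.add hq

noncomputable def EE (ι : Type*) [Fintype ι] (v : NNReal) : MvPolynomial ι ℕ →+ ℝ where
  toFun P := ∫ x : ι → ℝ, MvPolynomial.aeval x P ∂(Measure.pi fun _ => gaussianReal 0 v)
  map_zero' := by simp
  map_add' p q := by
    simp only [map_add]
    exact integral_add (p_int v p) (p_int v q)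

lemma EE_mon (v : NNReal) (s : ι →₀ ℕ) (c : ℕ) : EE ι v (MvPolynomial.monomial s c)
    = c * ∏ i, ∫ x : ℝ, x ^ s i ∂(gaussianReal 0 v) := by
  change ∫ x : ι → ℝ, MvPolynomial.aeval x _ ∂(Measure.pi fun _ => gaussianReal 0 v) = _
  simp only [ae_mon]
  rw [integral_const_mul, integral_fintype_prod_eq_prod (f := fun i (y : ℝ) => y ^ s i)]

lemma EE_nonneg (v : NNReal) (P : MvPolynomial ι ℕ) : 0 ≤ EE ι v P := by
  induction P using MvPolynomial.induction_on' with
  | monomial s c =>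
    rw [EE_mon]
    exact mul_nonneg (Nat.cast_nonneg _) (Finset.prod_nonneg fun i _ => g_nonneg v _)
  | add p q hp hq => rw [map_add]; exact add_nonneg hp hq

lemma EE_step (v : NNReal) (p : ι) (P : MvPolynomial ι ℕ) :
    v * EE ι v P ≤ EE ι v (MvPolynomial.X p ^ 2 * P) := by
  classical
  induction P using MvPolynomial.induction_on' with
  | monomial s c =>
    rw [MvPolynomial.X_pow_eq_monomial, MvPolynomial.monomial_mul, one_mul, EE_mon, EE_mon,
      ← Finset.mul_prod_erase _ _ (Finset.mem_univ p),
      ← Finset.mul_prod_erase _ (fun i => ∫ x : ℝ, x ^ ((Finsupp.single p 2 + s : ι →₀ ℕ) i) ∂(gaussianReal 0 v))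
        (Finset.mem_univ p)]
    have h : ∏ i ∈ Finset.univ.erase p, ∫ x : ℝ, x ^ ((Finsupp.single p 2 + s : ι →₀ ℕ) i) ∂(gaussianReal 0 v)
       = ∏ i ∈ Finset.univ.erase p, ∫ x : ℝ, x ^ (s i) ∂(gaussianReal 0 v) := by
      refine Finset.prod_congr rfl fun i hi => ?_
      have : p ≠ i := (Finset.ne_of_mem_erase hi).symm
      simp [Finsupp.single_apply, this]
    rw [h]
    have h1 := g_step v (s p)
    have h2 : 0 ≤ ∏ i ∈ Finset.univ.erase p, ∫ x : ℝ, x ^ (s i) ∂(gaussianReal 0 v) :=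
      Finset.prod_nonneg fun i _ => g_nonneg v _
    have h3 : (Finsupp.single p 2 + s : ι →₀ ℕ) p = s p + 2 := by simp [add_comm]
    rw [h3]
    have := mul_le_mul_of_nonneg_left (mul_le_mul_of_nonneg_right h1 h2) (Nat.cast_nonneg (α := ℝ) c)
    calc _ = _ := by ring
      _ ≤ _ := this
  | add p q hp hq => rw [mul_add, map_add, map_add]; linarith
end

noncomputable def FF (N : ℕ) (l : ℕ) : Fin N → MvPolynomial (Fin N × Fin N) ℕ :=
  ((Matrix.of fun i j => MvPolynomial.X (i, j)) ^ l) *ᵥ (fun _ => 1)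

lemma FF_succ (N l : ℕ) (k : Fin N) :
    FF N (l + 1) k = ∑ i, MvPolynomial.X (k, i) * FF N l i := by
  unfold FF
  rw [pow_succ', ← Matrix.mulVec_mulVec]
  rfl

lemma FF_eval (N l : ℕ) (A : Matrix (Fin N) (Fin N) ℝ) (k : Fin N) :
    MvPolynomial.aeval (fun p : Fin N × Fin N => A p.1 p.2) (FF N l k)
      = ((A ^ l) *ᵥ (fun _ => 1)) k := by
  induction l generalizing k with
  | zero => simp [FF]
  | succ l ih =>
    rw [FF_succ, pow_succ', ← Matrix.mulVec_mulVec]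
    simp only [map_sum, map_mul, ih, MvPolynomial.aeval_X]
    rfl

theorem stmt14 {Ω : Type*} [MeasurableSpace Ω] (μ : Measure Ω) [IsProbabilityMeasure μ]
    (N : ℕ) (hN : 0 < N) (σ : ℝ) (hσ : 0 < σ)
    (W : Ω → Matrix (Fin N) (Fin N) ℝ)
    (hWmeas : ∀ i j, Measurable fun ω => W ω i j)
    (hlaw : Measure.map (fun ω => fun p : Fin N × Fin N => W ω p.1 p.2) μ
      = Measure.pi fun _ => gaussianReal 0 (Real.toNNReal (σ ^ 2)))
    (T : ℕ)
    (u : Fin N → ℝ) (hu : u = fun _ => 1)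
    (Bf : ℕ → ℕ → ℝ)
    (hBdef : ∀ l₁ l₂ : ℕ,
      Bf l₁ l₂ = ∫ ω, ∑ i, ((W ω ^ l₁) *ᵥ u) i * ((W ω ^ l₂) *ᵥ u) i ∂μ) :
    ∀ l₁ l₂ : ℕ, l₁ < T → l₂ < T →
      Bf l₁ l₂ ≤ (1 / (σ ^ 2 * (N : ℝ))) * Bf (l₁ + 1) (l₂ + 1) := by
  intro l₁ l₂ _ _
  set v := Real.toNNReal (σ ^ 2) with hv
  have hvs : (v : ℝ) = σ ^ 2 := Real.coe_toNNReal _ (sq_nonneg σ)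
  have key : ∀ a b, Bf a b = ∑ i, EE (Fin N × Fin N) v (FF N a i * FF N b i) := by
    intro a b
    rw [hBdef, ← map_sum]
    change _ = ∫ x, MvPolynomial.aeval x _ ∂(Measure.pi fun _ => gaussianReal 0 v)
    rw [← hlaw, integral_map]
    · simp only [map_sum, map_mul, FF_eval, hu]
    · exact (measurable_pi_lambda _ fun p : Fin N × Fin N => hWmeas p.1 p.2).aemeasurable
    · rw [hlaw]; exact (p_int v _).aestronglyMeasurable
  have main : ∀ k, σ ^ 2 * Bf l₁ l₂ ≤
      EE (Fin N × Fin N) v (FF N (l₁+1) k * FF N (l₂+1) k) := by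
    intro k
    rw [key, FF_succ, FF_succ, Finset.sum_mul_sum, map_sum, Finset.mul_sum]
    refine Finset.sum_le_sum fun i _ => ?_
    rw [map_sum]
    refine le_trans ?_ (Finset.single_le_sum (fun j _ => EE_nonneg v _) (Finset.mem_univ i))
    rw [← hvs]
    refine (EE_step v (k, i) _).trans (le_of_eq ?_)
    congr 1; ring
  have hN' : (0:ℝ) < N := Nat.cast_pos.2 hN
  have tot : (N : ℝ) * (σ ^ 2 * Bf l₁ l₂) ≤ Bf (l₁+1) (l₂+1) := by
    rw [key (l₁+1)]
    simpa using Finset.sum_le_sum fun k (_ : k ∈ Finset.univ) => main k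
  rw [one_div, inv_mul_eq_div, le_div_iff₀ (by positivity)]
  linarith
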